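/- arXiv:2202.01700 — 3 statements merged into one kernel-verified Lean document; each statement's English description precedes it below -/
import Mathlib

section
/- Let μ be a probability measure on ℝ and let b ≥ 1 be such that μ([−b, b]) ≥ 1/2. Let k ≥ 2 be an integer and let μ^k = μ ⊗ ⋯ ⊗ μ denote the k-fold product measure on ℝ^k. Then for all ε ∈ (0, 1), μ^k({x ∈ ℝ^k : |x_i − x_j| ≤ ε for all i ≠ j}) ≥ ε^{k−1} / (2^{3k−2} · b^{k−1}). -/
open MeasureTheory
open scoped ENNReal

/-- If the boxes `A i ^ k` over a disjoint finite family `A` of measurable sets lie in `S`, and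
the `A i` cover a set of measure at least `1/2`, then `S` has `k`-fold product measure
at least `(1/2) ^ k / N ^ (k - 1)`, where `N` is the number of sets. -/
theorem half_pow_div_card_pow_le_pi_of_disjoint_boxes {α : Type*} [MeasurableSpace α]
    (μ : Measure α) [IsProbabilityMeasure μ] (s : Finset ℕ) (A : ℕ → Set α)
    (hA : ∀ i, MeasurableSet (A i)) (hd : Pairwise (Function.onFun Disjoint A))
    (B : Set α) (hB : (1 / 2 : ℝ) ≤ μ.real B) (hcover : B ⊆ ⋃ i ∈ s, A i)
    (n : ℕ) (S : Set (Fin (n + 1) → α)) (hS : ∀ i ∈ s, Set.univ.pi (fun _ => A i) ⊆ S) :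
    (1 / 2 : ℝ) ^ (n + 1) / (s.card : ℝ) ^ n ≤ (Measure.pi fun _ : Fin (n + 1) => μ).real S := by
  have hsum : (1 / 2 : ℝ) ≤ ∑ i ∈ s, μ.real (A i) :=
    hB.trans ((measureReal_mono hcover (measure_ne_top _ _)).trans
      (measureReal_biUnion_finset_le s A))
  have hbox : ∀ i, (Measure.pi fun _ : Fin (n + 1) => μ).real (Set.univ.pi fun _ => A i) =
      μ.real (A i) ^ (n + 1) := by
    intro i
    simp [Measure.real, Measure.pi_pi]
  calc (1 / 2 : ℝ) ^ (n + 1) / (s.card : ℝ) ^ n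
      ≤ (∑ i ∈ s, μ.real (A i)) ^ (n + 1) / (s.card : ℝ) ^ n := by gcongr
    _ ≤ ∑ i ∈ s, μ.real (A i) ^ (n + 1) :=
        pow_sum_div_card_le_sum_pow (fun _ _ => measureReal_nonneg) n
    _ = (Measure.pi fun _ : Fin (n + 1) => μ).real (⋃ i ∈ s, Set.univ.pi fun _ => A i) := by
        rw [measureReal_biUnion_finset]
        · simp only [hbox]
        · intro i _ j _ hij
          exact Set.disjoint_univ_pi.2 ⟨0, hd hij⟩
        · exact fun i _ => MeasurableSet.univ_pi fun _ => hA i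
    _ ≤ (Measure.pi fun _ : Fin (n + 1) => μ).real S :=
        measureReal_mono (Set.iUnion₂_subset hS)

/-- Lemma: diagonal lower bound for product measures.
Let `μ` be a probability measure on `ℝ` and `b ≥ 1` with `μ [-b, b] ≥ 1/2`. For `k ≥ 2`
and `ε ∈ (0,1)`, the `k`-fold product measure of the set of points whose coordinates are
pairwise within `ε` of each other is at least `ε^(k-1) / (2^(3k-2) b^(k-1))`. -/
theorem product_measure_diagonal_lower_bound
    (μ : Measure ℝ) [IsProbabilityMeasure μ] (b : ℝ) (hb : 1 ≤ b)
    (hμb : (1 / 2 : ℝ≥0∞) ≤ μ (Set.Icc (-b) b))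
    (k : ℕ) (hk : 2 ≤ k) (ε : ℝ) (hε0 : 0 < ε) (hε1 : ε < 1) :
    ENNReal.ofReal (ε ^ (k - 1) / (2 ^ (3 * k - 2) * b ^ (k - 1))) ≤
      Measure.pi (fun _ : Fin k => μ)
        {x : Fin k → ℝ | ∀ i j : Fin k, i ≠ j → |x i - x j| ≤ ε} := by
  obtain ⟨n, rfl⟩ : ∃ n, k = n + 1 := ⟨k - 1, by omega⟩
  -- The cells are half-open intervals of length `ε`, the fibres of `x ↦ ⌊(x + b) / ε⌋`.
  let A : ℕ → Set ℝ := fun i => {x | ⌊(x + b) / ε⌋ = (i : ℤ)}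
  set N : ℕ := ⌊2 * b / ε⌋₊ + 1 with hN
  have hNle : (N : ℝ) ≤ 4 * b / ε := by
    have h1 : (⌊2 * b / ε⌋₊ : ℝ) ≤ 2 * b / ε := Nat.floor_le (by positivity)
    have h2 : 1 ≤ 2 * b / ε := by rw [le_div_iff₀ hε0]; linarith
    have h3 : 4 * b / ε = 2 * b / ε + 2 * b / ε := by ring
    rw [hN]; push_cast; linarith
  have hhalf : (1 / 2 : ℝ) ≤ μ.real (Set.Icc (-b) b) := by
    have := ENNReal.toReal_mono (measure_ne_top μ _) hμb
    simpa [Measure.real] using this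
  have key := half_pow_div_card_pow_le_pi_of_disjoint_boxes μ (Finset.range N) A
    (fun i => by
      have hm : Measurable fun x : ℝ => ⌊(x + b) / ε⌋ := by fun_prop
      exact hm (measurableSet_singleton (i : ℤ)))
    (by
      intro i j hij
      refine Set.disjoint_left.2 fun x hi hj => hij ?_
      exact_mod_cast (hi : ⌊(x + b) / ε⌋ = (i : ℤ)).symm.trans hj)
    (Set.Icc (-b) b) hhalf
    (by
      rintro x ⟨h1, h2⟩
      have hx0 : 0 ≤ (x + b) / ε := div_nonneg (by linarith) hε0.le
      refine Set.mem_iUnion₂.2 ⟨⌊(x + b) / ε⌋₊, ?_, ?_⟩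
      · rw [Finset.mem_range, hN, Nat.lt_succ_iff]
        apply Nat.floor_le_floor
        gcongr
        linarith
      · exact (Int.natCast_floor_eq_floor hx0).symm)
    n {x : Fin (n + 1) → ℝ | ∀ i j, i ≠ j → |x i - x j| ≤ ε}
    (by
      intro m _ x hx i j _
      have hi : ⌊(x i + b) / ε⌋ = (m : ℤ) := hx i trivial
      have hj : ⌊(x j + b) / ε⌋ = (m : ℤ) := hx j trivial
      have h := Int.abs_sub_lt_one_of_floor_eq_floor (hi.trans hj.symm)
      rw [← sub_div, abs_div, abs_of_pos hε0, div_lt_one hε0] at h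
      simpa using h.le)
  refine ENNReal.ofReal_le_of_le_toReal (le_trans ?_ key)
  have hNpos : (0 : ℝ) < N := by rw [hN]; positivity
  have hexp : 3 * (n + 1) - 2 = (n + 1) + 2 * n := by omega
  calc ε ^ (n + 1 - 1) / (2 ^ (3 * (n + 1) - 2) * b ^ (n + 1 - 1))
      = (1 / 2 : ℝ) ^ (n + 1) / (4 * b / ε) ^ n := by
        rw [hexp, Nat.add_sub_cancel, pow_add, pow_mul, div_pow, div_pow, mul_pow]
        norm_num
        field_simp
    _ ≤ (1 / 2 : ℝ) ^ (n + 1) / ((Finset.range N).card : ℝ) ^ n := by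
        rw [Finset.card_range]
        gcongr
end

section
/- For every κ with 0 < κ < √2/3 there exists a constant c > 0 such that for all w ∈ ℝ, ∫_ℝ exp( 2κ·sgn(t)·|t|^{3/2} − 4(t − w) − (2√2/3)·((t − w)⁺)^{3/2} ) dt ≤ c·exp( 2w + c·(w⁺)^{3/2} ). -/
open MeasureTheory Real

/-- A linear function is dominated by a small multiple of `x ^ (3 / 2)` up to a constant. -/
lemma mul_le_mul_rpow_three_halves_add {K ε x : ℝ} (hK : 0 < K) (hε : 0 < ε) (hx : 0 ≤ x) :
    K * x ≤ ε * x ^ ((3 : ℝ) / 2) + K ^ 3 / ε ^ 2 := by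
  have hp : x ^ ((3 : ℝ) / 2) = √x ^ 3 := by
    rw [Real.sqrt_eq_rpow, ← Real.rpow_natCast, ← Real.rpow_mul hx]
    norm_num
  have hs : 0 ≤ √x := Real.sqrt_nonneg x
  have hxs : x = √x ^ 2 := (Real.sq_sqrt hx).symm
  rw [hp]
  rcases le_total K (ε * √x) with h | h
  · have h1 : K * √x ^ 2 ≤ ε * √x * √x ^ 2 := by gcongr
    have h2 : 0 ≤ K ^ 3 / ε ^ 2 := by positivity
    rw [← hxs] at h1
    nlinarith [hxs]
  · have h1 : √x ≤ K / ε := by rw [le_div_iff₀ hε]; linarith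
    have h2 : K * √x ^ 2 ≤ K * (K / ε) ^ 2 := by gcongr
    have h3 : K * (K / ε) ^ 2 = K ^ 3 / ε ^ 2 := by ring
    have h4 : 0 ≤ ε * √x ^ 3 := by positivity
    rw [← hxs, h3] at h2
    linarith

/-- Quasi-subadditivity of `x ^ (3 / 2)` with constant arbitrarily close to `1` on one summand. -/
lemma exists_rpow_three_halves_add_le {r : ℝ} (hr : 1 < r) :
    ∃ M : ℝ, 0 < M ∧ ∀ x y : ℝ, 0 ≤ x → 0 ≤ y →
      (x + y) ^ ((3 : ℝ) / 2) ≤ r * x ^ ((3 : ℝ) / 2) + M * y ^ ((3 : ℝ) / 2) := by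
  have hr0 : 0 ≤ r := by linarith
  obtain ⟨η, hη⟩ : ∃ η, η = r ^ ((2 : ℝ) / 3) - 1 := ⟨_, rfl⟩
  have hη0 : 0 < η := by
    have := Real.one_lt_rpow hr (show (0 : ℝ) < 2 / 3 by norm_num)
    linarith
  have hηr : (1 + η) ^ ((3 : ℝ) / 2) = r := by
    rw [hη, add_sub_cancel, ← Real.rpow_mul hr0]
    norm_num
  refine ⟨(1 + 1 / η) ^ ((3 : ℝ) / 2), by positivity, fun x y hx hy => ?_⟩
  rcases le_total y (η * x) with h | h
  · calc (x + y) ^ ((3 : ℝ) / 2) ≤ ((1 + η) * x) ^ ((3 : ℝ) / 2) := by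
          gcongr
          linarith
      _ = r * x ^ ((3 : ℝ) / 2) := by rw [Real.mul_rpow (by positivity) hx, hηr]
      _ ≤ _ := le_add_of_nonneg_right (by positivity)
  · have hxy : x ≤ 1 / η * y := by
      rw [one_div, ← div_eq_inv_mul, le_div_iff₀ hη0]
      linarith
    calc (x + y) ^ ((3 : ℝ) / 2) ≤ ((1 + 1 / η) * y) ^ ((3 : ℝ) / 2) := by
          gcongr
          linarith
      _ = (1 + 1 / η) ^ ((3 : ℝ) / 2) * y ^ ((3 : ℝ) / 2) :=
          Real.mul_rpow (by positivity) hy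
      _ ≤ _ := le_add_of_nonneg_left (by positivity)

/-- Pointwise bound on the exponent of the kernel. -/
lemma exists_kernel_exponent_le {a b : ℝ} (ha : 0 < a) (hab : a < b) :
    ∃ A C : ℝ, 0 < A ∧ ∀ t w : ℝ,
      a * Real.sign t * |t| ^ ((3 : ℝ) / 2) - 4 * (t - w) - b * (max (t - w) 0) ^ ((3 : ℝ) / 2) ≤
        C + (2 * w + A * (max w 0) ^ ((3 : ℝ) / 2)) - |t| := by
  obtain ⟨M, hM, hadd⟩ := exists_rpow_three_halves_add_le ((one_lt_div ha).2 hab)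
  refine ⟨a * M + 1, 8 + 5 ^ 3 / a ^ 2, by positivity, fun t w => ?_⟩
  have hC : 0 < 5 ^ 3 / a ^ 2 := by positivity
  have hw : 0 ≤ (max w 0) ^ ((3 : ℝ) / 2) := by positivity
  have hd : 0 ≤ b * (max (t - w) 0) ^ ((3 : ℝ) / 2) :=
    mul_nonneg (ha.trans hab).le (by positivity)
  have hMw : 0 ≤ a * M * (max w 0) ^ ((3 : ℝ) / 2) := by positivity
  have hlin := mul_le_mul_rpow_three_halves_add two_pos one_pos (le_max_right w 0)
  have hwm := le_max_left w 0
  rcases lt_or_ge t 0 with ht | ht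
  · have hlt := mul_le_mul_rpow_three_halves_add (K := 5) (by norm_num) ha (abs_nonneg t)
    rw [Real.sign_of_neg ht]
    rw [abs_of_neg ht] at hlt ⊢
    linarith
  · have hsplit : t ^ ((3 : ℝ) / 2) ≤ (max (t - w) 0 + max w 0) ^ ((3 : ℝ) / 2) := by
      gcongr
      linarith [le_max_left (t - w) 0]
    have hsign : a * Real.sign t * |t| ^ ((3 : ℝ) / 2) ≤ a * t ^ ((3 : ℝ) / 2) := by
      rw [abs_of_nonneg ht]
      rcases ht.eq_or_lt with rfl | ht
      · simp
      · rw [Real.sign_of_pos ht, mul_one]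
    have hup := mul_le_mul_of_nonneg_left
      (hsplit.trans (hadd _ _ (le_max_right (t - w) 0) (le_max_right w 0))) ha.le
    rw [mul_add, ← mul_assoc, mul_div_cancel₀ b ha.ne', ← mul_assoc] at hup
    rw [abs_of_nonneg ht] at hsign ⊢
    linarith

lemma integrable_exp_neg_abs_real : Integrable fun t : ℝ => Real.exp (-|t|) := by
  rw [← integrableOn_univ, ← Set.Iic_union_Ioi (a := (0 : ℝ)), integrableOn_union]
  refine ⟨(integrableOn_exp_Iic 0).congr_fun (fun t ht => ?_) measurableSet_Iic,
    (integrableOn_exp_neg_Ioi 0).congr_fun (fun t ht => ?_) measurableSet_Ioi⟩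
  · simp [abs_of_nonpos (Set.mem_Iic.1 ht)]
  · simp [abs_of_pos (Set.mem_Ioi.1 ht)]

/-- Integral bound for the `R_w` kernel.
For every `0 < κ < √2/3` there is `c > 0` such that for all `w ∈ ℝ`,
`∫ exp(2κ sgn(t) |t|^{3/2} − 4(t − w) − (2√2/3)((t−w)⁺)^{3/2}) dt
  ≤ c exp(2w + c (w⁺)^{3/2})`. -/
theorem kernel_integral_bound
    (κ : ℝ) (hκ0 : 0 < κ) (hκ1 : κ < Real.sqrt 2 / 3) :
    ∃ c : ℝ, 0 < c ∧ ∀ w : ℝ,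
      (∫⁻ t : ℝ, ENNReal.ofReal (Real.exp (2 * κ * Real.sign t * |t| ^ ((3 : ℝ) / 2)
          - 4 * (t - w) - (2 * Real.sqrt 2 / 3) * (max (t - w) 0) ^ ((3 : ℝ) / 2)))) ≤
        ENNReal.ofReal (c * Real.exp (2 * w + c * (max w 0) ^ ((3 : ℝ) / 2))) := by
  obtain ⟨A, C, hA, hle⟩ := exists_kernel_exponent_le (a := 2 * κ) (b := 2 * √2 / 3)
    (by positivity) (by linarith)
  obtain ⟨I, hI⟩ : ∃ I, I = ∫ t : ℝ, Real.exp (-|t|) := ⟨_, rfl⟩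
  have hI0 : 0 ≤ I := hI ▸ integral_nonneg fun t => (Real.exp_pos _).le
  have hCI : 0 ≤ Real.exp C * I := by positivity
  refine ⟨A + Real.exp C * I, by positivity, fun w => ?_⟩
  obtain ⟨B, hB⟩ : ∃ B, B = 2 * w + A * (max w 0) ^ ((3 : ℝ) / 2) := ⟨_, rfl⟩
  calc _ ≤ ∫⁻ t : ℝ, ENNReal.ofReal (Real.exp (C + B) * Real.exp (-|t|)) := by
        refine lintegral_mono fun t => ENNReal.ofReal_le_ofReal ?_
        rw [← Real.exp_add, hB, ← sub_eq_add_neg]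
        exact Real.exp_le_exp.2 (hle t w)
    _ = ENNReal.ofReal (∫ t : ℝ, Real.exp (C + B) * Real.exp (-|t|)) :=
        (ofReal_integral_eq_lintegral_ofReal (integrable_exp_neg_abs_real.const_mul _)
          (.of_forall fun t => by positivity)).symm
    _ = ENNReal.ofReal (Real.exp C * I * Real.exp B) := by
        rw [integral_const_mul, ← hI, Real.exp_add]
        ring_nf
    _ ≤ _ := by
        rw [hB]
        gcongr <;> linarith
end

section
/- For every c₀ > 0 there exists a constant c > 0 such that for all real numbers a ≤ b, ∫_{−b}^{−a} ∫_0^∞ exp( 2x + 4v + c₀·(v⁺)^{3/2} + c₀·((x + v)⁺)^{3/2} − x²/8 ) dx dv ≤ c·(b − a)·exp( c·(a⁻)^{3/2} ). -/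
open MeasureTheory

/-- Subadditivity of `t ↦ t ^ (3/2)` up to the constant `4`. -/
lemma add_rpow_three_halves_le {x y : ℝ} (hx : 0 ≤ x) (hy : 0 ≤ y) :
    (x + y) ^ ((3 : ℝ) / 2) ≤ 4 * (x ^ ((3 : ℝ) / 2) + y ^ ((3 : ℝ) / 2)) := by
  have key : ∀ {s t : ℝ}, 0 ≤ s → s ≤ t →
      (s + t) ^ ((3 : ℝ) / 2) ≤ 4 * t ^ ((3 : ℝ) / 2) := by
    intro s t hs hst
    have ht : 0 ≤ t := hs.trans hst
    calc (s + t) ^ ((3 : ℝ) / 2) ≤ (2 * t) ^ ((3 : ℝ) / 2) :=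
          Real.rpow_le_rpow (by positivity) (by linarith) (by norm_num)
      _ = 2 ^ ((3 : ℝ) / 2) * t ^ ((3 : ℝ) / 2) := Real.mul_rpow (by norm_num) ht
      _ ≤ 2 ^ (2 : ℝ) * t ^ ((3 : ℝ) / 2) := by
          gcongr <;> norm_num
      _ = 4 * t ^ ((3 : ℝ) / 2) := by norm_num
  have hx' := Real.rpow_nonneg hx ((3 : ℝ) / 2)
  have hy' := Real.rpow_nonneg hy ((3 : ℝ) / 2)
  rcases le_total x y with h | h
  · linarith [key hx h]
  · rw [add_comm x y]
    linarith [key hy h]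

lemma rpow_three_halves_eq {x : ℝ} (hx : 0 ≤ x) : x ^ ((3 : ℝ) / 2) = x * √x := by
  rw [show ((3 : ℝ) / 2) = 1 + 1 / 2 by norm_num,
    Real.rpow_add_of_nonneg hx (by norm_num) (by norm_num), Real.rpow_one, Real.sqrt_eq_rpow]

lemma le_one_add_rpow_three_halves {x : ℝ} (hx : 0 ≤ x) : x ≤ 1 + x ^ ((3 : ℝ) / 2) := by
  rcases le_total x 1 with h | h
  · linarith [Real.rpow_nonneg hx ((3 : ℝ) / 2)]
  · linarith [Real.self_le_rpow_of_one_le h (show (1 : ℝ) ≤ 3 / 2 by norm_num)]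

/-- The Gaussian term absorbs the linear and `3/2`-power growth in `x`, leaving decay `-x`. -/
lemma linear_add_rpow_sub_sq_le (c₀ : ℝ) {x : ℝ} (hx : 0 ≤ x) :
    2 * x + 4 * c₀ * x ^ ((3 : ℝ) / 2) - x ^ 2 / 8 ≤ 3 * (3 + 128 * c₀ ^ 2) ^ 2 - x := by
  rw [rpow_three_halves_eq hx]
  have hs : √x ^ 2 = x := Real.sq_sqrt hx
  have h₁ : 4 * c₀ * (x * √x) ≤ x ^ 2 / 32 + 128 * c₀ ^ 2 * x := by
    have h := sq_nonneg (x - 64 * c₀ * √x)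
    have e : (x - 64 * c₀ * √x) ^ 2 = x ^ 2 - 128 * c₀ * (x * √x) + 4096 * c₀ ^ 2 * x := by
      linear_combination 4096 * c₀ ^ 2 * hs
    linarith
  nlinarith [sq_nonneg (3 * x - 16 * (3 + 128 * c₀ ^ 2)), sq_nonneg (3 + 128 * c₀ ^ 2)]

lemma exponent_le {c₀ x v M : ℝ} (hc₀ : 0 ≤ c₀) (hx : 0 ≤ x) (hM : 0 ≤ M) (hv : v ≤ M) :
    2 * x + 4 * v + c₀ * (max v 0) ^ ((3 : ℝ) / 2)
        + c₀ * (max (x + v) 0) ^ ((3 : ℝ) / 2) - x ^ 2 / 8 ≤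
      4 + 3 * (3 + 128 * c₀ ^ 2) ^ 2 + (4 + 5 * c₀) * M ^ ((3 : ℝ) / 2) + -x := by
  have h₁ : (max v 0) ^ ((3 : ℝ) / 2) ≤ M ^ ((3 : ℝ) / 2) :=
    Real.rpow_le_rpow (le_max_right _ _) (max_le hv hM) (by norm_num)
  have h₂ : (max (x + v) 0) ^ ((3 : ℝ) / 2) ≤
      4 * (x ^ ((3 : ℝ) / 2) + M ^ ((3 : ℝ) / 2)) :=
    (Real.rpow_le_rpow (le_max_right _ _) (max_le (by linarith) (by positivity))
      (by norm_num)).trans (add_rpow_three_halves_le hx hM)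
  linarith [mul_le_mul_of_nonneg_left h₁ hc₀, mul_le_mul_of_nonneg_left h₂ hc₀,
    le_one_add_rpow_three_halves hM, linear_add_rpow_sub_sq_le c₀ hx]

lemma lintegral_exp_neg_Ici_zero :
    ∫⁻ x in Set.Ici (0 : ℝ), ENNReal.ofReal (Real.exp (-x)) = 1 := by
  rw [setLIntegral_congr Ioi_ae_eq_Ici.symm,
    ← ofReal_integral_eq_lintegral_ofReal (integrableOn_exp_neg_Ioi 0)
      (Filter.Eventually.of_forall fun x => (Real.exp_pos _).le), integral_exp_neg_Ioi_zero]
  simp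

/-- Double integral bound, boundary-crossing part.
For every `c₀ > 0` there is `c > 0` such that for all `a ≤ b`,
`∫_{−b}^{−a} ∫_0^∞ exp(2x + 4v + c₀ (v⁺)^{3/2} + c₀ ((x+v)⁺)^{3/2} − x²/8) dx dv
  ≤ c (b − a) exp(c (a⁻)^{3/2})`. -/
theorem double_integral_bound_strip
    (c₀ : ℝ) (hc₀ : 0 < c₀) :
    ∃ c : ℝ, 0 < c ∧ ∀ a b : ℝ, a ≤ b →
      (∫⁻ v in Set.Icc (-b) (-a), ∫⁻ x in Set.Ici (0 : ℝ),
          ENNReal.ofReal (Real.exp (2 * x + 4 * v + c₀ * (max v 0) ^ ((3 : ℝ) / 2)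
            + c₀ * (max (x + v) 0) ^ ((3 : ℝ) / 2) - x ^ 2 / 8))) ≤
        ENNReal.ofReal (c * (b - a) * Real.exp (c * (max (-a) 0) ^ ((3 : ℝ) / 2))) := by
  set K : ℝ := 4 + 3 * (3 + 128 * c₀ ^ 2) ^ 2
  refine ⟨Real.exp K + (4 + 5 * c₀), by positivity, fun a b hab => ?_⟩
  set M : ℝ := max (-a) 0
  have hM : 0 ≤ M := le_max_right _ _
  set C : ℝ := Real.exp (K + (4 + 5 * c₀) * M ^ ((3 : ℝ) / 2)) with hC
  have inner_le : ∀ v ∈ Set.Icc (-b) (-a), (∫⁻ x in Set.Ici (0 : ℝ),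
      ENNReal.ofReal (Real.exp (2 * x + 4 * v + c₀ * (max v 0) ^ ((3 : ℝ) / 2)
        + c₀ * (max (x + v) 0) ^ ((3 : ℝ) / 2) - x ^ 2 / 8))) ≤ ENNReal.ofReal C := by
    intro v hv
    calc _ ≤ ∫⁻ x in Set.Ici (0 : ℝ), ENNReal.ofReal C * ENNReal.ofReal (Real.exp (-x)) := by
          refine setLIntegral_mono' measurableSet_Ici fun x hx => ?_
          rw [← ENNReal.ofReal_mul (Real.exp_pos _).le, ← Real.exp_add]
          exact ENNReal.ofReal_le_ofReal (Real.exp_le_exp.2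
            (exponent_le hc₀.le hx hM (hv.2.trans (le_max_left _ _))))
      _ = ENNReal.ofReal C := by
          rw [lintegral_const_mul' _ _ ENNReal.ofReal_ne_top, lintegral_exp_neg_Ici_zero, mul_one]
  calc _ ≤ ∫⁻ _ in Set.Icc (-b) (-a), ENNReal.ofReal C :=
        setLIntegral_mono' measurableSet_Icc inner_le
    _ = ENNReal.ofReal (C * (b - a)) := by
        rw [setLIntegral_const, Real.volume_Icc, ← ENNReal.ofReal_mul (Real.exp_pos _).le]
        congr 2
        ring
    _ ≤ _ := by
        refine ENNReal.ofReal_le_ofReal ?_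
        have hba : 0 ≤ b - a := sub_nonneg.2 hab
        rw [hC, Real.exp_add, mul_right_comm]
        gcongr ?_ * _ * Real.exp (?_ * _)
        · linarith
        · linarith [Real.exp_pos K]
end
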